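/- Suppose that the polyhedra Δ_{i,j} ⊂ ℝ^m, for i = 1,…,n and j = 1,…,p, are pairwise parallel. Then for each n-tuple of nonnegative integers a_1, …, a_n with a_1 + … + a_n = p, the intersection ( {(a_1,…,a_{n−1})} × ℝ^m ) ∩ ( (Δ_{1,1} * … * Δ_{n,1}) + … + (Δ_{1,p} * … * Δ_{n,p}) ) equals {(a_1,…,a_{n−1})} × ( ⋁_{J_1 ⊔ … ⊔ J_n = {1,…,p}, |J_1| = a_1, …, |J_n| = a_n} Σ_{i = 1,…,n, j ∈ J_i} Δ_{i,j} ) inside ℝ^{n−1} ⊕ ℝ^m, where the join ⋁ (convex hull of the union) is over all decompositions of {1,…,p} into disjoint sets J_i with |J_i| = a_i, and a Minkowski sum over an empty index set equals {0}. -/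

import Mathlib

/-!
STATEMENT 8 (slices of sums of Cayley polyhedra).
For pairwise parallel polyhedra `Δ_{i,j} ⊂ ℝ^m` (`i = 1,…,n`, `j = 1,…,p`) and any
nonnegative integers `a_1 + … + a_n = p`:
`({(a_1,…,a_{n−1})} × ℝ^m) ∩ ((Δ_{1,1}*…*Δ_{n,1}) + … + (Δ_{1,p}*…*Δ_{n,p}))
 = {(a_1,…,a_{n−1})} × ⋁_{J_1⊔…⊔J_n={1,…,p}, |J_i|=a_i} Σ_{i, j∈J_i} Δ_{i,j}`
inside `ℝ^{n−1} ⊕ ℝ^m`, modelled as `(Fin (n−1) → ℝ) × (Fin m → ℝ)`.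
-/

open Set

noncomputable section

/-- A polyhedron: an intersection of finitely many closed half-spaces. -/
def IsPolyhedron {m : ℕ} (A : Set (Fin m → ℝ)) : Prop :=
  ∃ (N : ℕ) (γ : Fin N → ((Fin m → ℝ) →ₗ[ℝ] ℝ)) (c : Fin N → ℝ),
    A = ⋂ t, {x | c t ≤ γ t x}

/-- Two subsets of `ℝ^m` are parallel. -/
def Parallel {m : ℕ} (A B : Set (Fin m → ℝ)) : Prop :=
  ∀ a : Fin m → ℝ, ((fun x => a + x) '' A ⊆ A ↔ (fun x => a + x) '' B ⊆ B)

/-- Minkowski sum of the sets `Δ j`, `j ∈ J` (`{0}` when `J = ∅`). -/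
def minkSum {ι E : Type*} [AddCommMonoid E] (J : Finset ι) (Δ : ι → Set E) : Set E :=
  {y | ∃ x : ι → E, (∀ j ∈ J, x j ∈ Δ j) ∧ y = ∑ j ∈ J, x j}

/-- The Cayley points `b_1,…,b_n ∈ ℝ^{n−1}`: the standard basis vectors and `b_n = 0`. -/
def cayleyPt (n : ℕ) (i : Fin n) : Fin (n - 1) → ℝ :=
  fun l => if (i : ℕ) = (l : ℕ) then 1 else 0

/-- The Cayley polyhedron `Δ_1 * … * Δ_n ⊂ ℝ^{n−1} ⊕ ℝ^m`. -/
def cayley (n m : ℕ) (Δ : Fin n → Set (Fin m → ℝ)) :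
    Set ((Fin (n - 1) → ℝ) × (Fin m → ℝ)) :=
  convexHull ℝ (⋃ i, {cayleyPt n i} ×ˢ Δ i)

/-- The join `⋁_{J_1⊔…⊔J_n={1,…,p}, |J_i|=a_i} Σ_{i, j∈J_i} Δ_{i,j}`. -/
def joinOfPartitions {m n p : ℕ} (Δ : Fin n → Fin p → Set (Fin m → ℝ))
    (a : Fin n → ℕ) : Set (Fin m → ℝ) :=
  convexHull ℝ (⋃ f ∈ {f : Fin p → Fin n |
      ∀ i, (Finset.univ.filter (fun j => f j = i)).card = a i},
    minkSum Finset.univ (fun j => Δ (f j) j))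

lemma IsPolyhedron.convex {m : ℕ} {A : Set (Fin m → ℝ)} (hA : IsPolyhedron A) : Convex ℝ A := by
  obtain ⟨N, γ, c, rfl⟩ := hA
  exact convex_iInter fun t => convex_halfSpace_ge (γ t).isLinear (c t)

/-- Membership in the convex hull of a finite union of convex sets, some of which may be empty:
one point of each set with nonzero weight is enough. -/
lemma exists_weights_of_mem_convexHull_iUnion {ι E : Type*} [Fintype ι] [AddCommGroup E]
    [Module ℝ E] {s : ι → Set E} (hs : ∀ i, Convex ℝ (s i)) {y : E}
    (hy : y ∈ convexHull ℝ (⋃ i, s i)) :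
    ∃ (w : ι → ℝ) (x : ι → E), (∀ i, 0 ≤ w i) ∧ ∑ i, w i = 1 ∧
      (∀ i, w i ≠ 0 → x i ∈ s i) ∧ ∑ i, w i • x i = y := by
  classical
  obtain ⟨κ, _, v, z, hv, hv1, hz, rfl⟩ := mem_convexHull_iff_exists_fintype.1 hy
  choose g hg using fun k => mem_iUnion.1 (hz k)
  refine ⟨fun i => ∑ k with g k = i, v k, fun i => (Finset.univ.filter (g · = i)).centerMass v z,
    fun i => Finset.sum_nonneg fun k _ => hv k, ?_, fun i hi => ?_, ?_⟩
  · rw [← hv1]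
    exact Finset.sum_fiberwise _ g v
  · refine (hs i).centerMass_mem (fun k _ => hv k)
      (lt_of_le_of_ne (Finset.sum_nonneg fun k _ => hv k) hi.symm) fun k hk => ?_
    obtain rfl := (Finset.mem_filter.1 hk).2
    exact hg k
  · rw [← Finset.sum_fiberwise _ g]
    refine Finset.sum_congr rfl fun i _ => ?_
    simp only [Finset.centerMass]
    by_cases h : ∑ k with g k = i, v k = 0
    · have h0 := (Finset.sum_eq_zero_iff_of_nonneg fun k _ => hv k).1 h
      rw [h, zero_smul]
      exact (Finset.sum_eq_zero fun k hk => by rw [h0 k hk, zero_smul]).symm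
    · rw [smul_inv_smul₀ h]

/-- A nonnegative matrix with column sums `1` and integer row sums `a i` is a convex combination
of the `0`-`1` matrices of maps with fibers of cardinality `a i`. -/
lemma exists_convex_combination_of_maps {ι κ : Type*} [Fintype ι] [Fintype κ] [DecidableEq ι]
    [DecidableEq κ] (a : ι → ℕ) (ha : ∑ i, a i = Fintype.card κ) (w : ι → κ → ℝ)
    (hw : ∀ i j, 0 ≤ w i j) (hcol : ∀ j, ∑ i, w i j = 1) (hrow : ∀ i, ∑ j, w i j = a i) :
    ∃ (c : Equiv.Perm κ → ℝ) (f : Equiv.Perm κ → κ → ι), (∀ σ, 0 ≤ c σ) ∧ ∑ σ, c σ = 1 ∧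
      (∀ σ i, (Finset.univ.filter (fun j => f σ j = i)).card = a i) ∧
      ∀ i j, w i j = ∑ σ, if f σ j = i then c σ else 0 := by
  let e : κ ≃ Σ i, Fin (a i) := Fintype.equivOfCardEq (by simp [ha])
  have hfib (h : ι → ℝ) : ∑ k, h (e k).1 = ∑ i, a i * h i := by
    rw [e.sum_comp (fun s => h s.1), Fintype.sum_sigma]
    simp
  have hpos (k : κ) : (a (e k).1 : ℝ) ≠ 0 := by
    have := (e k).2.pos
    positivity
  have hcancel (i : ι) (j : κ) : a i * (w i j / a i) = w i j := by
    by_cases h : (a i : ℝ) = 0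
    · have := hrow i
      rw [h, Finset.sum_eq_zero_iff_of_nonneg fun j _ => hw i j] at this
      simp [this j (Finset.mem_univ j)]
    · field_simp
  let M : Matrix κ κ ℝ := fun k j => w (e k).1 j / a (e k).1
  have hM : M ∈ doublyStochastic ℝ κ := by
    refine mem_doublyStochastic_iff_sum.2
      ⟨fun k j => div_nonneg (hw _ _) (Nat.cast_nonneg _), fun k => ?_, fun j => ?_⟩
    · simp only [M]
      rw [← Finset.sum_div, hrow, div_self (hpos k)]
    · simp only [M]
      rw [hfib fun i => w i j / a i]
      simp only [hcancel, hcol]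
  obtain ⟨c, hc, hc1, hcM⟩ := exists_eq_sum_perm_of_mem_doublyStochastic hM
  refine ⟨c, fun σ j => (e (σ.symm j)).1, hc, hc1, fun σ i => ?_, fun i j => ?_⟩
  · have h := hfib fun i' => if i' = i then 1 else 0
    rw [← σ.symm.sum_comp] at h
    simpa using h
  · have h := hfib fun i' => if i' = i then w i' j / a i' else 0
    simp only [mul_ite, mul_zero, Finset.sum_ite_eq', Finset.mem_univ, if_true, hcancel] at h
    rw [← h]
    have hMk (k : κ) : w (e k).1 j / a (e k).1 = ∑ σ, if σ.symm j = k then c σ else 0 := by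
      change M k j = _
      rw [← hcM, Matrix.sum_apply]
      refine Finset.sum_congr rfl fun σ _ => ?_
      simp only [Matrix.smul_apply, PEquiv.toMatrix_toPEquiv_apply, Pi.single_apply,
        Equiv.symm_apply_eq, smul_eq_mul, mul_ite, mul_one, mul_zero]
    simp only [hMk]
    have (k : κ) : (if (e k).1 = i then ∑ σ : Equiv.Perm κ, if σ.symm j = k then c σ else 0 else 0)
        = ∑ σ : Equiv.Perm κ, if σ.symm j = k then (if (e k).1 = i then c σ else 0) else 0 := by
      split_ifs <;> simp
    simp only [this]
    rw [Finset.sum_comm]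
    simp

lemma exists_weights_of_mem_cayley {n m : ℕ} {Δ : Fin n → Set (Fin m → ℝ)}
    (hΔ : ∀ i, Convex ℝ (Δ i)) {y : (Fin (n - 1) → ℝ) × (Fin m → ℝ)} (hy : y ∈ cayley n m Δ) :
    ∃ (w : Fin n → ℝ) (x : Fin n → Fin m → ℝ), (∀ i, 0 ≤ w i) ∧ ∑ i, w i = 1 ∧
      (∀ i, w i ≠ 0 → x i ∈ Δ i) ∧ (∀ l, y.1 l = w (Fin.castLE (Nat.sub_le n 1) l)) ∧
      y.2 = ∑ i, w i • x i := by
  obtain ⟨w, x, hw, hw1, hx, rfl⟩ :=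
    exists_weights_of_mem_convexHull_iUnion (fun i => (convex_singleton _).prod (hΔ i)) hy
  refine ⟨w, fun i => (x i).2, hw, hw1, fun i hi => (hx i hi).2, fun l => ?_, by simp [Prod.snd_sum]⟩
  have (i : Fin n) : (w i • x i).1 l = if i = Fin.castLE (Nat.sub_le n 1) l then w i else 0 := by
    by_cases hi : w i = 0
    · simp [hi]
    · have h : (x i).1 = cayleyPt n i := (hx i hi).1
      simp [h, cayleyPt, Fin.ext_iff]
  rw [Prod.fst_sum, Finset.sum_apply]
  simp [this]

/-- A family indexed by `Fin n` is determined by its total and its first `n - 1` members. -/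
lemma eq_of_sum_eq_of_castLE_eq {n : ℕ} {r s : Fin n → ℝ} (hsum : ∑ i, r i = ∑ i, s i)
    (h : ∀ l : Fin (n - 1),
      r (Fin.castLE (Nat.sub_le n 1) l) = s (Fin.castLE (Nat.sub_le n 1) l)) (i : Fin n) :
    r i = s i := by
  cases n with
  | zero => exact i.elim0
  | succ k =>
    have h' (l : Fin k) : r l.castSucc = s l.castSucc := h l
    rw [Fin.sum_univ_castSucc, Fin.sum_univ_castSucc] at hsum
    simp only [h', add_right_inj] at hsum
    exact Fin.lastCases hsum h' i

lemma convex_minkSum {ι E : Type*} [AddCommGroup E] [Module ℝ E] (J : Finset ι) {Δ : ι → Set E}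
    (hΔ : ∀ j ∈ J, Convex ℝ (Δ j)) : Convex ℝ (minkSum J Δ) := by
  rintro _ ⟨x, hx, rfl⟩ _ ⟨y, hy, rfl⟩ s t hs ht hst
  refine ⟨fun j => s • x j + t • y j, fun j hj => hΔ j hj (hx j hj) (hy j hj) hs ht hst, ?_⟩
  simp [Finset.smul_sum, Finset.sum_add_distrib]

lemma sum_cayleyPt {n p : ℕ} {f : Fin p → Fin n} {a : Fin n → ℕ}
    (hf : ∀ i, (Finset.univ.filter (fun j => f j = i)).card = a i) :
    ∑ j, cayleyPt n (f j) = fun l => (a (Fin.castLE (Nat.sub_le n 1) l) : ℝ) := by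
  ext l
  simp [← hf, cayleyPt, Fin.ext_iff]

lemma slice_subset_join {m n p : ℕ} {Δ : Fin n → Fin p → Set (Fin m → ℝ)}
    (hΔ : ∀ i j, Convex ℝ (Δ i j)) {a : Fin n → ℕ} (hsum : ∑ i, a i = p) {v : Fin m → ℝ}
    (hv : (fun l => (a (Fin.castLE (Nat.sub_le n 1) l) : ℝ), v) ∈
      minkSum Finset.univ (fun j => cayley n m (fun i => Δ i j))) :
    v ∈ joinOfPartitions Δ a := by
  obtain ⟨z, hz, hzv⟩ := hv
  choose w x hw hw1 hx hwz hxz using fun j =>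
    exists_weights_of_mem_cayley (fun i => hΔ i j) (hz j (Finset.mem_univ j))
  obtain ⟨hz1, hz2⟩ := Prod.ext_iff.1 hzv
  rw [Prod.fst_sum] at hz1
  rw [Prod.snd_sum] at hz2
  have hrow : ∀ i, ∑ j, w j i = a i := by
    refine eq_of_sum_eq_of_castLE_eq ?_ fun l => ?_
    · rw [Finset.sum_comm, ← Nat.cast_sum, hsum]
      simp [hw1]
    · simpa [hwz] using (congrFun hz1 l).symm
  obtain ⟨c, f, hc, hc1, hf, hcw⟩ := exists_convex_combination_of_maps a (by simpa using hsum)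
    (fun i j => w j i) (fun i j => hw j i) hw1 hrow
  have hvc : v = ∑ σ, c σ • ∑ j, x j (f σ j) := by
    simp only at hz2
    simp only [hz2, hxz, hcw, Finset.sum_smul, Finset.smul_sum, ite_smul, zero_smul]
    conv_rhs => rw [Finset.sum_comm]
    refine Finset.sum_congr rfl fun j _ => ?_
    rw [Finset.sum_comm]
    simp
  rw [hvc, ← finsum_eq_sum_of_fintype]
  refine (convex_convexHull ℝ _).finsum_mem hc (by rwa [finsum_eq_sum_of_fintype])
    fun σ hσ => subset_convexHull ℝ _ <| mem_biUnion (hf σ) ⟨_, fun j _ => hx j _ ?_, rfl⟩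
  rw [hcw]
  refine ne_of_gt <| ((hc σ).lt_of_ne' hσ).trans_le ?_
  refine le_trans (by simp) (Finset.single_le_sum
    (f := fun τ => if f τ j = f σ j then c τ else 0) (fun τ _ => ?_) (Finset.mem_univ σ))
  split_ifs
  exacts [hc τ, le_rfl]

lemma join_subset_slice {m n p : ℕ} {Δ : Fin n → Fin p → Set (Fin m → ℝ)} {a : Fin n → ℕ}
    {v : Fin m → ℝ} (hv : v ∈ joinOfPartitions Δ a) :
    (fun l => (a (Fin.castLE (Nat.sub_le n 1) l) : ℝ), v) ∈
      minkSum Finset.univ (fun j => cayley n m (fun i => Δ i j)) := by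
  have hconv := convex_minkSum (Finset.univ : Finset (Fin p))
    (Δ := fun j => cayley n m (fun i => Δ i j)) fun j _ => convex_convexHull ℝ _
  rw [joinOfPartitions] at hv
  have hmem := mk_mem_convexHull_prod (R := ℝ) (subset_convexHull ℝ _ (mem_singleton
    (fun l : Fin (n - 1) => (a (Fin.castLE (Nat.sub_le n 1) l) : ℝ)))) hv
  refine convexHull_min ?_ hconv hmem
  rintro ⟨u, y⟩ ⟨hu, hy⟩
  obtain rfl : u = _ := hu
  obtain ⟨f, hf, x, hx, hxy⟩ := mem_iUnion₂.1 hy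
  refine ⟨fun j => (cayleyPt n (f j), x j), fun j hj => subset_convexHull ℝ _ <|
    mem_iUnion.2 ⟨f j, mem_singleton _, hx j hj⟩, ?_⟩
  ext1
  · rw [Prod.fst_sum, sum_cayleyPt hf]
  · rw [Prod.snd_sum]
    exact hxy

theorem slice_of_sum_of_cayley_polyhedra {m n p : ℕ}
    (Δ : Fin n → Fin p → Set (Fin m → ℝ))
    (hpoly : ∀ i j, IsPolyhedron (Δ i j))
    (hpar : ∀ i j i' j', Parallel (Δ i j) (Δ i' j'))
    (a : Fin n → ℕ) (hsum : ∑ i, a i = p) :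
    ({fun l : Fin (n - 1) => (a (Fin.castLE (Nat.sub_le n 1) l) : ℝ)} ×ˢ
        (Set.univ : Set (Fin m → ℝ))) ∩
      minkSum Finset.univ (fun j => cayley n m (fun i => Δ i j)) =
    {fun l : Fin (n - 1) => (a (Fin.castLE (Nat.sub_le n 1) l) : ℝ)} ×ˢ
      joinOfPartitions Δ a := by
  ext ⟨u, v⟩
  constructor
  · rintro ⟨⟨hu, -⟩, hv⟩
    obtain rfl : u = _ := hu
    exact ⟨rfl, slice_subset_join (fun i j => (hpoly i j).convex) hsum hv⟩
  · rintro ⟨hu, hv⟩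
    obtain rfl : u = _ := hu
    exact ⟨⟨rfl, mem_univ _⟩, join_subset_slice hv⟩
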